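/- arXiv:2210.12832 — 6 statements merged into one kernel-verified Lean document; each statement's English description precedes it below -/
import Mathlib

section
/- (Theorem 1, Causal Identifiability of FLiNG-BN, finite coefficient-space formulation) Suppose (B, π, τ, σ) and (B', π', τ', σ') are two parameterizations such that: B (resp. B') is acyclic; for every node pair (j,k) the exogenous mixture has M_{jk} ≥ 2 (resp. M'_{jk} ≥ 2) components with strictly positive weights summing to one and pairwise distinct strictly positive variances; and every noise variance σ_j > 0 (resp. σ'_j > 0). If the two FLiNG-BN observation laws on (Fin p × Fin K) → ℝ coincide as probability measures, then B = B'; in particular, for all j ≠ ℓ, the causal graph of B has edge ℓ → j if and only if the causal graph of B' does. -/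
open MeasureTheory ProbabilityTheory
open scoped NNReal

/-- A coefficient matrix `B` on `(Fin p × Fin K)` is acyclic if it has zero diagonal blocks and
there is an ordering `r` of the `p` nodes under which nonzero off-diagonal blocks point strictly
downwards. -/
def IsAcyclicCoef {p K : ℕ} (B : Matrix (Fin p × Fin K) (Fin p × Fin K) ℝ) : Prop :=
  (∀ j k k', B (j, k) (j, k') = 0) ∧
    ∃ r : Fin p → ℕ, ∀ j k ℓ k', B (j, k) (ℓ, k') ≠ 0 → j ≠ ℓ → r ℓ < r j

/-- The causal graph of `B` has an edge `ℓ → j` iff some entry of the block `B_{jℓ}` is nonzero. -/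
def HasEdge {p K : ℕ} (B : Matrix (Fin p × Fin K) (Fin p × Fin K) ℝ) (j ℓ : Fin p) : Prop :=
  ∃ k k', B (j, k) (ℓ, k') ≠ 0

/-- The FLiNG-BN observation law on `(Fin p × Fin K) → ℝ`: the convolution of the pushforward of
the product of the exogenous mixture laws `ν` under the linear map `(I - B)⁻¹` with the product
of the coordinatewise Gaussian observation-noise laws. -/
noncomputable def flingObsLaw {p K : ℕ} (B : Matrix (Fin p × Fin K) (Fin p × Fin K) ℝ)
    (ν : Fin p × Fin K → Measure ℝ) (σ : Fin p → ℝ≥0) : Measure (Fin p × Fin K → ℝ) :=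
  Measure.map (fun x : (Fin p × Fin K → ℝ) × (Fin p × Fin K → ℝ) => x.1 + x.2)
    ((Measure.map (fun z => (1 - B)⁻¹.mulVec z) (Measure.pi ν)).prod
      (Measure.pi fun i => gaussianReal 0 (σ i.1)))

/-- Finitely many linear forms that do not vanish identically on a subspace are simultaneously
nonzero at some point of it. -/
lemma exists_mem_forall_apply_ne_zero {κ k E : Type*} [Finite κ] [Field k] [Infinite k]
    [AddCommGroup E] [Module k E] (W : Submodule k E) (f : κ → E →ₗ[k] k)
    (h : ∀ i, ¬ W ≤ LinearMap.ker (f i)) : ∃ w ∈ W, ∀ i, f i w ≠ 0 := by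
  by_contra! hcon
  have hcover : ⋃ i, ((LinearMap.ker ((f i).comp W.subtype) : Submodule k W) : Set W) =
      Set.univ := by
    refine Set.eq_univ_of_forall fun w => ?_
    obtain ⟨i, hi⟩ := hcon w w.2
    exact Set.mem_iUnion.2 ⟨i, hi⟩
  obtain ⟨i, hi⟩ := Subspace.exists_eq_top_of_iUnion_eq_univ hcover
  refine h i fun w hw => ?_
  have hmem : (⟨w, hw⟩ : W) ∈ LinearMap.ker ((f i).comp W.subtype) := hi ▸ Submodule.mem_top
  exact hmem

/-- If two weighted hyperplane arrangements have the same weight function, where a point is given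
the product of the weights in `(0, 1)` of the hyperplanes that miss it, then each hyperplane of the
first is contained in one of the second. -/
lemma exists_ker_le_ker_of_prod_ite_eq {ι κ E : Type*} [Fintype ι] [Fintype κ]
    [AddCommGroup E] [Module ℝ E] {f : ι → E →ₗ[ℝ] ℝ} {g : κ → E →ₗ[ℝ] ℝ}
    (hf : ∀ i, f i ≠ 0) (hg : ∀ j, g j ≠ 0) {c : ι → ℝ} {d : κ → ℝ}
    (hc0 : ∀ i, 0 < c i) (hc1 : ∀ i, c i < 1)
    (h : ∀ u, ∏ i, (if f i u = 0 then 1 else c i) = ∏ j, (if g j u = 0 then 1 else d j)) (i : ι) :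
    ∃ j, LinearMap.ker (f i) ≤ LinearMap.ker (g j) := by
  by_contra! hcon
  obtain ⟨u, -, hu⟩ := exists_mem_forall_apply_ne_zero ⊤ (Sum.elim f g) (by
    rintro (i | j)
    · simpa [LinearMap.ker_eq_top] using hf i
    · simpa [LinearMap.ker_eq_top] using hg j)
  obtain ⟨w, hw, hwg⟩ := exists_mem_forall_apply_ne_zero (LinearMap.ker (f i)) g hcon
  have huf : ∀ i, f i u ≠ 0 := fun i => hu (Sum.inl i)
  have hug : ∀ j, g j u ≠ 0 := fun j => hu (Sum.inr j)
  have h1 := h u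
  have h2 := h w
  simp only [huf, hug, hwg, if_false] at h1 h2
  have hlt : ∏ i, c i < ∏ i, (if f i w = 0 then 1 else c i) := by
    refine Finset.prod_lt_prod (fun k _ => hc0 k) (fun k _ => ?_) ⟨i, Finset.mem_univ i, ?_⟩
    · split_ifs
      exacts [(hc1 k).le, le_rfl]
    · rw [if_pos (LinearMap.mem_ker.1 hw)]
      exact hc1 i
  exact hlt.ne (h1.trans h2.symm)

/-- A sequence has at most one Gaussian decay rate, and at that rate at most one leading
coefficient. -/
lemma eq_of_tendsto_mul_exp_sq {F : ℕ → ℝ} {q q' c c' : ℝ} (hc : 0 < c) (hc' : 0 < c')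
    (h : Filter.Tendsto (fun n : ℕ => F n * Real.exp ((n : ℝ) ^ 2 * q)) Filter.atTop (nhds c))
    (h' : Filter.Tendsto (fun n : ℕ => F n * Real.exp ((n : ℝ) ^ 2 * q')) Filter.atTop (nhds c')) :
    c = c' := by
  wlog hqq : q ≤ q' generalizing q q' c c'
  · exact (this hc' hc h' h (le_of_not_ge hqq)).symm
  rcases hqq.eq_or_lt with rfl | hlt
  · exact tendsto_nhds_unique h h'
  · exfalso
    have hsq : Filter.Tendsto (fun n : ℕ => (n : ℝ) ^ 2 * (q - q')) Filter.atTop Filter.atBot :=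
      ((Filter.tendsto_pow_atTop two_ne_zero).comp
        tendsto_natCast_atTop_atTop).atTop_mul_const_of_neg (sub_neg.2 hlt)
    have hlim := h'.mul (Real.tendsto_exp_atBot.comp hsq)
    rw [mul_zero] at hlim
    refine hc.ne' (tendsto_nhds_unique h (hlim.congr fun n => ?_))
    rw [Function.comp_apply, mul_assoc, ← Real.exp_add]
    ring_nf

/-- Along a ray, a mixture of centred Gaussian characteristic functions decays at the rate given by
the smallest variance. -/
lemma tendsto_mixture_mul_exp_sq {M : ℕ} {w τ : Fin M → ℝ≥0} (hw : ∑ m, w m = 1)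
    (hτ : Function.Injective τ) {m₀ : Fin M} (hmin : ∀ m, τ m₀ ≤ τ m) (x : ℝ) :
    Filter.Tendsto (fun n : ℕ => (∑ m, (w m : ℝ) * Real.exp (-(τ m * ((n : ℝ) * x) ^ 2 / 2))) *
      Real.exp ((n : ℝ) ^ 2 * (τ m₀ * x ^ 2 / 2))) Filter.atTop
      (nhds (if x = 0 then 1 else (w m₀ : ℝ))) := by
  have hw' : ∑ m, (w m : ℝ) = 1 := by exact_mod_cast hw
  split_ifs with hx
  · simp [hx, hw']
  have hterm : ∀ m, Filter.Tendsto
      (fun n : ℕ => (w m : ℝ) * Real.exp ((n : ℝ) ^ 2 * (-((τ m - τ m₀) * x ^ 2 / 2))))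
      Filter.atTop (nhds (if m = m₀ then (w m₀ : ℝ) else 0)) := by
    intro m
    split_ifs with hm
    · simp [hm]
    · have hlt : (τ m₀ : ℝ) < τ m := by
        exact_mod_cast lt_of_le_of_ne (hmin m) fun h => hm (hτ h).symm
      have hneg : -(((τ m : ℝ) - τ m₀) * x ^ 2 / 2) < 0 := by
        have := mul_pos (sub_pos.2 hlt) (by positivity : 0 < x ^ 2)
        linarith
      have hsq : Filter.Tendsto
          (fun n : ℕ => (n : ℝ) ^ 2 * (-(((τ m : ℝ) - τ m₀) * x ^ 2 / 2)))
          Filter.atTop Filter.atBot :=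
        ((Filter.tendsto_pow_atTop two_ne_zero).comp
          tendsto_natCast_atTop_atTop).atTop_mul_const_of_neg hneg
      simpa using (Real.tendsto_exp_atBot.comp hsq).const_mul (w m : ℝ)
  have hsum := tendsto_finsetSum Finset.univ fun m _ => hterm m
  simp only [Finset.sum_ite_eq', Finset.mem_univ, if_true] at hsum
  refine hsum.congr fun n => ?_
  rw [Finset.sum_mul]
  refine Finset.sum_congr rfl fun m _ => ?_
  rw [mul_assoc, ← Real.exp_add]
  ring_nf

lemma charFun_gaussian_mixture {M : ℕ} (w τ : Fin M → ℝ≥0) (t : ℝ) :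
    charFun (∑ m, w m • gaussianReal 0 (τ m)) t =
      ((∑ m, (w m : ℝ) * Real.exp (-(τ m * t ^ 2 / 2)) : ℝ) : ℂ) := by
  have hint : ∀ m, Integrable (fun x : ℝ => Complex.exp (t * x * Complex.I))
      (w m • gaussianReal 0 (τ m)) := fun m => by
    refine Integrable.of_bound (C := 1) (by fun_prop) (Filter.Eventually.of_forall fun x => ?_)
    rw [← Complex.ofReal_mul, Complex.norm_exp_ofReal_mul_I]
  rw [charFun_apply_real, integral_finsetSum_measure fun m _ => hint m]
  push_cast
  refine Finset.sum_congr rfl fun m _ => ?_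
  rw [integral_smul_nnreal_measure, ← charFun_apply_real, charFun_gaussianReal, NNReal.smul_def,
    Complex.real_smul]
  simp

lemma integral_exp_dotProduct_pi {ι : Type*} [Fintype ι] (μ : ι → Measure ℝ)
    [∀ i, SigmaFinite (μ i)] (u : ι → ℝ) :
    ∫ x, Complex.exp ((u ⬝ᵥ x : ℝ) * Complex.I) ∂(Measure.pi μ) = ∏ i, charFun (μ i) (u i) := by
  simp_rw [charFun_apply_real]
  rw [← integral_fintype_prod_eq_prod (fun i (x : ℝ) => Complex.exp (u i * x * Complex.I))]
  refine integral_congr_ae (Filter.Eventually.of_forall fun x => ?_)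
  simp [dotProduct, ← Complex.exp_sum, Finset.sum_mul]

lemma integral_exp_dotProduct_flingObsLaw {p K : ℕ}
    (B : Matrix (Fin p × Fin K) (Fin p × Fin K) ℝ) (ν : Fin p × Fin K → Measure ℝ)
    [∀ i, SigmaFinite (ν i)] (σ : Fin p → ℝ≥0) (u : Fin p × Fin K → ℝ) :
    ∫ x, Complex.exp ((u ⬝ᵥ x : ℝ) * Complex.I) ∂(flingObsLaw B ν σ) =
      (∏ i, charFun (ν i) (Matrix.vecMul u (1 - B)⁻¹ i)) *
        ∏ i : Fin p × Fin K, charFun (gaussianReal 0 (σ i.1)) (u i) := by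
  have hdot : Continuous fun x : Fin p × Fin K → ℝ =>
      Complex.exp ((u ⬝ᵥ x : ℝ) * Complex.I) := by
    unfold dotProduct
    fun_prop
  have hA : Measurable fun z : Fin p × Fin K → ℝ => (1 - B)⁻¹.mulVec z :=
    (Continuous.matrix_mulVec continuous_const continuous_id).measurable
  rw [flingObsLaw, integral_map (by fun_prop) hdot.aestronglyMeasurable]
  simp only [dotProduct_add, Complex.ofReal_add, add_mul, Complex.exp_add]
  rw [integral_prod_mul (fun x => Complex.exp ((u ⬝ᵥ x : ℝ) * Complex.I))
    (fun x => Complex.exp ((u ⬝ᵥ x : ℝ) * Complex.I)),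
    integral_map hA.aemeasurable hdot.aestronglyMeasurable, integral_exp_dotProduct_pi]
  simp only [Matrix.dotProduct_mulVec]
  rw [integral_exp_dotProduct_pi]

/-- The characteristic function of the observation law decays along every ray at a Gaussian rate,
with leading coefficient the product of the weights of the smallest-variance components over the
exogenous coordinates that the ray sees. -/
lemma exists_tendsto_flingObsLaw_mul_exp_sq {p K : ℕ}
    (B : Matrix (Fin p × Fin K) (Fin p × Fin K) ℝ) {M : Fin p × Fin K → ℕ}
    {w τ : (i : Fin p × Fin K) → Fin (M i) → ℝ≥0} (hw : ∀ i, ∑ m, w i m = 1)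
    (hτ : ∀ i, Function.Injective (τ i)) (σ : Fin p → ℝ≥0) {m₀ : ∀ i, Fin (M i)}
    (hmin : ∀ i m, τ i (m₀ i) ≤ τ i m) (u : Fin p × Fin K → ℝ) :
    ∃ q : ℝ, Filter.Tendsto (fun n : ℕ =>
      (∫ x, Complex.exp ((((n : ℝ) • u) ⬝ᵥ x : ℝ) * Complex.I)
        ∂(flingObsLaw B (fun i => ∑ m, w i m • gaussianReal 0 (τ i m)) σ)).re *
          Real.exp ((n : ℝ) ^ 2 * q)) Filter.atTop
      (nhds (∏ i, if Matrix.vecMul u (1 - B)⁻¹ i = 0 then 1 else (w i (m₀ i) : ℝ))) := by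
  set x : Fin p × Fin K → ℝ := Matrix.vecMul u (1 - B)⁻¹ with hx
  refine ⟨∑ i, (τ i (m₀ i) : ℝ) * x i ^ 2 / 2 + ∑ i : Fin p × Fin K, (σ i.1 : ℝ) * u i ^ 2 / 2, ?_⟩
  have hlim := tendsto_finsetProd Finset.univ fun i _ =>
    tendsto_mixture_mul_exp_sq (hw i) (hτ i) (hmin i) (x i)
  refine hlim.congr fun n => ?_
  have hgauss : ∀ i : Fin p × Fin K, charFun (gaussianReal 0 (σ i.1)) (((n : ℝ) • u) i) =
      ((Real.exp (-((n : ℝ) ^ 2 * (σ i.1 * u i ^ 2 / 2))) : ℝ) : ℂ) := fun i => by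
    rw [charFun_gaussianReal]
    push_cast [Pi.smul_apply, smul_eq_mul]
    ring_nf
  rw [integral_exp_dotProduct_flingObsLaw]
  simp only [hgauss, charFun_gaussian_mixture, Matrix.smul_vecMul, ← hx]
  simp only [Pi.smul_apply, smul_eq_mul]
  rw [← Complex.ofReal_prod, ← Complex.ofReal_prod, ← Complex.ofReal_mul, Complex.ofReal_re,
    Finset.prod_mul_distrib, mul_assoc, ← Real.exp_sum, ← Real.exp_sum, ← Real.exp_add]
  congr 2
  rw [mul_add, Finset.mul_sum, Finset.mul_sum, Finset.sum_neg_distrib]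
  ring

namespace IsAcyclicCoef

variable {p K : ℕ} {B : Matrix (Fin p × Fin K) (Fin p × Fin K) ℝ}

lemma rank_lt (hB : IsAcyclicCoef B) {r : Fin p → ℕ}
    (hr : ∀ j k ℓ k', B (j, k) (ℓ, k') ≠ 0 → j ≠ ℓ → r ℓ < r j) {i l : Fin p × Fin K}
    (h : B i l ≠ 0) : r l.1 < r i.1 := by
  obtain ⟨j, k⟩ := i
  obtain ⟨ℓ, k'⟩ := l
  refine hr j k ℓ k' h ?_
  rintro rfl
  exact h (hB.1 j k k')

lemma isUnit_one_sub (hB : IsAcyclicCoef B) : IsUnit (1 - B) := by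
  obtain ⟨r, hr⟩ := hB.2
  rw [← Matrix.mulVec_injective_iff_isUnit]
  refine (injective_iff_map_eq_zero (1 - B).mulVecLin).2 fun v hv => ?_
  have hfix : v = B.mulVec v := by
    rwa [Matrix.mulVecLin_apply, Matrix.sub_mulVec, Matrix.one_mulVec, sub_eq_zero] at hv
  ext i
  induction hn : r i.1 using Nat.strong_induction_on generalizing i with
  | _ n ih =>
    rw [hfix, Pi.zero_apply]
    refine Finset.sum_eq_zero fun l _ => mul_eq_zero.2 (or_iff_not_imp_left.2 fun hl => ?_)
    exact ih (r l.1) (hn ▸ hB.rank_lt hr hl) l rfl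

lemma vecMul_row_inv (hB : IsAcyclicCoef B) (i : Fin p × Fin K) :
    Matrix.vecMul ((1 - B).row i) (1 - B)⁻¹ = Pi.single i 1 := by
  rw [← Matrix.single_one_vecMul i (1 - B), Matrix.vecMul_vecMul,
    Matrix.mul_nonsing_inv _ ((Matrix.isUnit_iff_isUnit_det _).1 hB.isUnit_one_sub),
    Matrix.vecMul_one]

/-- The total-effect matrix is block unitriangular. -/
lemma inv_apply_eq_one_apply (hB : IsAcyclicCoef B) {r : Fin p → ℕ}
    (hr : ∀ j k ℓ k', B (j, k) (ℓ, k') ≠ 0 → j ≠ ℓ → r ℓ < r j) (i i' : Fin p × Fin K)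
    (h : r i.1 ≤ r i'.1) :
    (1 - B)⁻¹ i i' = (1 : Matrix (Fin p × Fin K) (Fin p × Fin K) ℝ) i i' := by
  have hA : (1 - B)⁻¹ = 1 + B * (1 - B)⁻¹ := by
    have := Matrix.mul_nonsing_inv (1 - B) ((Matrix.isUnit_iff_isUnit_det _).1 hB.isUnit_one_sub)
    rw [sub_mul, one_mul] at this
    exact sub_eq_iff_eq_add.1 this
  induction hn : r i.1 using Nat.strong_induction_on generalizing i with
  | _ n ih =>
    rw [hA, Matrix.add_apply, add_eq_left, Matrix.mul_apply]
    refine Finset.sum_eq_zero fun l _ => ?_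
    by_cases hl : B i l = 0
    · rw [hl, zero_mul]
    · have hlt : r l.1 < r i.1 := hB.rank_lt hr hl
      rw [ih (r l.1) (hn ▸ hlt) l (hlt.le.trans h) rfl, Matrix.one_apply_ne, mul_zero]
      rintro rfl
      exact absurd h hlt.not_ge

end IsAcyclicCoef

/-- A block unitriangular total-effect matrix is determined by the kernels of its columns. -/
lemma inv_one_sub_eq_of_ker_le {p K : ℕ} {B B' : Matrix (Fin p × Fin K) (Fin p × Fin K) ℝ}
    (hB : IsAcyclicCoef B) (hB' : IsAcyclicCoef B')
    (h : ∀ i, ∃ j, ∀ u, Matrix.vecMul u (1 - B)⁻¹ i = 0 → Matrix.vecMul u (1 - B')⁻¹ j = 0) :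
    (1 - B)⁻¹ = (1 - B')⁻¹ := by
  choose s hs using h
  obtain ⟨r, hr⟩ := hB.2
  obtain ⟨r', hr'⟩ := hB'.2
  let c : Fin p × Fin K → ℝ := fun i => Matrix.vecMul ((1 - B).row i) (1 - B')⁻¹ (s i)
  have hprop : ∀ i u, Matrix.vecMul u (1 - B')⁻¹ (s i) =
      Matrix.vecMul u (1 - B)⁻¹ i * c i := fun i u => by
    have := hs i (u - Matrix.vecMul u (1 - B)⁻¹ i • (1 - B).row i) (by
      simp [Matrix.sub_vecMul, Matrix.smul_vecMul, hB.vecMul_row_inv])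
    rwa [Matrix.sub_vecMul, Matrix.smul_vecMul, Pi.sub_apply, Pi.smul_apply, smul_eq_mul,
      sub_eq_zero] at this
  have hcol : ∀ i l, (1 - B')⁻¹ l (s i) = (1 - B)⁻¹ l i * c i := fun i l => by
    simpa using hprop i (Pi.single l 1)
  have hdiag' : ∀ i, (1 - B')⁻¹ i i = 1 := fun i => by
    rw [hB'.inv_apply_eq_one_apply hr' i i le_rfl, Matrix.one_apply_eq]
  have hne : ∀ i, (1 - B)⁻¹ (s i) i * c i ≠ 0 := fun i => by
    rw [← hcol, hdiag']
    exact one_ne_zero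
  have hinj : Function.Injective s := fun i i' h => by
    by_contra hii
    refine right_ne_zero_of_mul (hne i) ?_
    have := hprop i' ((1 - B).row i)
    rwa [← h, hB.vecMul_row_inv, Pi.single_eq_of_ne (Ne.symm hii), zero_mul] at this
  have hstep : ∀ i, r (s i).1 ≤ r i.1 → s i = i := fun i hle => by
    by_contra hsi
    refine left_ne_zero_of_mul (hne i) ?_
    rw [hB.inv_apply_eq_one_apply hr _ _ hle, Matrix.one_apply_ne hsi]
  have hle : ∀ i, r i.1 ≤ r (s i).1 := fun i => by
    by_contra! hlt
    rw [hstep i hlt.le] at hlt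
    exact hlt.false
  have hsum : ∑ i : Fin p × Fin K, r i.1 = ∑ i, r (s i).1 :=
    (Equiv.sum_comp (Equiv.ofBijective s (Finite.injective_iff_bijective.1 hinj))
      fun i : Fin p × Fin K => r i.1).symm
  have hfix : ∀ i, s i = i := fun i =>
    hstep i ((Finset.sum_eq_sum_iff_of_le fun i _ => hle i).1 hsum i (Finset.mem_univ i)).ge
  ext l i
  have hone : c i = 1 := by
    have := hcol i i
    rw [hfix, hdiag', hB.inv_apply_eq_one_apply hr i i le_rfl, Matrix.one_apply_eq, one_mul] at this
    exact this.symm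
  have := hcol i l
  rw [hfix, hone, mul_one] at this
  exact this.symm

lemma proj_comp_vecMulLinear_inv_ne_zero {p K : ℕ}
    {B : Matrix (Fin p × Fin K) (Fin p × Fin K) ℝ} (hB : IsAcyclicCoef B) (i : Fin p × Fin K) :
    (LinearMap.proj i).comp (1 - B)⁻¹.vecMulLinear ≠ 0 := fun h => by
  have := LinearMap.congr_fun h ((1 - B).row i)
  simp [hB.vecMul_row_inv] at this

lemma lt_one_of_sum_eq_one {M : ℕ} (hM : 2 ≤ M) {w : Fin M → ℝ≥0} (hpos : ∀ m, 0 < w m)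
    (hsum : ∑ m, w m = 1) (m : Fin M) : w m < 1 := by
  have : Nontrivial (Fin M) := Fin.nontrivial_iff_two_le.2 hM
  obtain ⟨m', hm'⟩ := exists_ne m
  rw [← hsum]
  exact Finset.single_lt_sum hm' (Finset.mem_univ m) (Finset.mem_univ m') (hpos m')
    fun _ _ _ => zero_le

/-- **Causal identifiability of FLiNG-BN.**  If two acyclic FLiNG-BN parameterizations, each with
at least two mixture components per exogenous coordinate (with strictly positive weights summing
to one and pairwise distinct strictly positive variances) and strictly positive observation-noise
variances, induce the same observation law, then the direct causal effect matrices coincide; in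
particular the two causal graphs have exactly the same edges. -/
theorem fling_bn_causal_identifiability {p K : ℕ} (hp : 1 ≤ p) (hK : 1 ≤ K)
    (B B' : Matrix (Fin p × Fin K) (Fin p × Fin K) ℝ)
    (hB : IsAcyclicCoef B) (hB' : IsAcyclicCoef B')
    (M M' : Fin p × Fin K → ℕ) (hM : ∀ i, 2 ≤ M i) (hM' : ∀ i, 2 ≤ M' i)
    (π : (i : Fin p × Fin K) → Fin (M i) → ℝ≥0)
    (π' : (i : Fin p × Fin K) → Fin (M' i) → ℝ≥0)
    (hπpos : ∀ i m, 0 < π i m) (hπ'pos : ∀ i m, 0 < π' i m)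
    (hπsum : ∀ i, ∑ m, π i m = 1) (hπ'sum : ∀ i, ∑ m, π' i m = 1)
    (τ : (i : Fin p × Fin K) → Fin (M i) → ℝ≥0)
    (τ' : (i : Fin p × Fin K) → Fin (M' i) → ℝ≥0)
    (hτpos : ∀ i m, 0 < τ i m) (hτ'pos : ∀ i m, 0 < τ' i m)
    (hτdist : ∀ i, Function.Injective (τ i)) (hτ'dist : ∀ i, Function.Injective (τ' i))
    (σ σ' : Fin p → ℝ≥0) (hσ : ∀ j, 0 < σ j) (hσ' : ∀ j, 0 < σ' j)
    (hlaw : flingObsLaw B (fun i => ∑ m, π i m • gaussianReal 0 (τ i m)) σ =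
      flingObsLaw B' (fun i => ∑ m, π' i m • gaussianReal 0 (τ' i m)) σ') :
    B = B' ∧ ∀ j ℓ : Fin p, j ≠ ℓ → (HasEdge B j ℓ ↔ HasEdge B' j ℓ) := by
  have hBB : B = B' := by
    have hmin : ∀ i, ∃ m₀, ∀ m, τ i m₀ ≤ τ i m := fun i =>
      haveI : Nonempty (Fin (M i)) := ⟨⟨0, by have := hM i; omega⟩⟩
      Finite.exists_min (τ i)
    have hmin' : ∀ i, ∃ m₀, ∀ m, τ' i m₀ ≤ τ' i m := fun i =>
      haveI : Nonempty (Fin (M' i)) := ⟨⟨0, by have := hM' i; omega⟩⟩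
      Finite.exists_min (τ' i)
    choose m₀ hm₀ using hmin
    choose m₀' hm₀' using hmin'
    have hprod : ∀ u, ∏ i, (if Matrix.vecMul u (1 - B)⁻¹ i = 0 then 1 else (π i (m₀ i) : ℝ)) =
        ∏ i, (if Matrix.vecMul u (1 - B')⁻¹ i = 0 then 1 else (π' i (m₀' i) : ℝ)) := fun u => by
      obtain ⟨q, hq⟩ := exists_tendsto_flingObsLaw_mul_exp_sq B hπsum hτdist σ hm₀ u
      obtain ⟨q', hq'⟩ := exists_tendsto_flingObsLaw_mul_exp_sq B' hπ'sum hτ'dist σ' hm₀' u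
      rw [← hlaw] at hq'
      refine eq_of_tendsto_mul_exp_sq (Finset.prod_pos fun i _ => ?_)
        (Finset.prod_pos fun i _ => ?_) hq hq'
      · split_ifs
        exacts [one_pos, hπpos i _]
      · split_ifs
        exacts [one_pos, hπ'pos i _]
    have hker := exists_ker_le_ker_of_prod_ite_eq
      (f := fun i => (LinearMap.proj i).comp (1 - B)⁻¹.vecMulLinear)
      (g := fun i => (LinearMap.proj i).comp (1 - B')⁻¹.vecMulLinear)
      (proj_comp_vecMulLinear_inv_ne_zero hB) (proj_comp_vecMulLinear_inv_ne_zero hB')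
      (c := fun i => (π i (m₀ i) : ℝ)) (d := fun i => (π' i (m₀' i) : ℝ))
      (fun i => hπpos i _)
      (fun i => by exact_mod_cast lt_one_of_sum_eq_one (hM i) (hπpos i) (hπsum i) (m₀ i)) hprod
    have hinv := inv_one_sub_eq_of_ker_le hB hB' hker
    have hsub := Matrix.inv_inj hinv ((Matrix.isUnit_iff_isUnit_det _).1 hB.isUnit_one_sub)
    exact sub_right_injective hsub
  subst hBB
  exact ⟨rfl, fun _ _ _ => Iff.rfl⟩
end

section
/- (Example 2 construction, algebraic form) Let b, τ1, τ2, σ1, σ2 ∈ ℝ with b ≠ 0 and τ1, τ2, σ1, σ2 > 0, and let τ1', σ1' > 0 satisfy τ1' + σ1' < τ1 + σ1 − b²τ1²/(b²τ1 + τ2 + σ2). Define b' = (τ1 + σ1 − τ1' − σ1')/(b·τ1), τ2' = b²τ1²/(τ1 + σ1 − τ1' − σ1'), and σ2' = b²τ1 + τ2 + σ2 − b²τ1²/(τ1 + σ1 − τ1' − σ1'). Then τ2' > 0, σ2' > 0, and the 2×2 real matrices [[τ1 + σ1, bτ1], [bτ1, b²τ1 + τ2 + σ2]] and [[b'²τ2'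 + τ1' + σ1', b'τ2'], [b'τ2', τ2' + σ2']] are equal. -/
/-- **Example 2 construction (algebraic form).**  Given the causal linear Gaussian parameters
`(b, τ1, τ2, σ1, σ2)` with `b ≠ 0` and all variances positive, and any `τ1', σ1' > 0` with
`τ1' + σ1' < τ1 + σ1 − b²τ1²/(b²τ1 + τ2 + σ2)`, the displayed anti-causal parameters
`(b', τ2', σ2')` are positive (where applicable) and reproduce exactly the same 2×2 observation
covariance matrix. -/
theorem example2_anticausal_construction (b τ1 τ2 σ1 σ2 τ1' σ1' : ℝ)
    (hb : b ≠ 0) (hτ1 : 0 < τ1) (hτ2 : 0 < τ2) (hσ1 : 0 < σ1) (hσ2 : 0 < σ2)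
    (hτ1' : 0 < τ1') (hσ1' : 0 < σ1')
    (hlt : τ1' + σ1' < τ1 + σ1 - b ^ 2 * τ1 ^ 2 / (b ^ 2 * τ1 + τ2 + σ2)) :
    let b' := (τ1 + σ1 - τ1' - σ1') / (b * τ1)
    let τ2' := b ^ 2 * τ1 ^ 2 / (τ1 + σ1 - τ1' - σ1')
    let σ2' := b ^ 2 * τ1 + τ2 + σ2 - b ^ 2 * τ1 ^ 2 / (τ1 + σ1 - τ1' - σ1')
    0 < τ2' ∧ 0 < σ2' ∧
      (!![τ1 + σ1, b * τ1; b * τ1, b ^ 2 * τ1 + τ2 + σ2] : Matrix (Fin 2) (Fin 2) ℝ) =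
        !![b' ^ 2 * τ2' + τ1' + σ1', b' * τ2'; b' * τ2', τ2' + σ2'] := by
  intro b' τ2' σ2'
  have hc : 0 < b ^ 2 * τ1 ^ 2 := by positivity
  have hS : 0 < b ^ 2 * τ1 + τ2 + σ2 := by positivity
  have hcD : b ^ 2 * τ1 ^ 2 / (b ^ 2 * τ1 + τ2 + σ2) < τ1 + σ1 - τ1' - σ1' := by linarith
  have hD : 0 < τ1 + σ1 - τ1' - σ1' := (div_pos hc hS).trans hcD
  have hoff : b' * τ2' = b * τ1 := by
    simp only [b', τ2']
    field_simp
  have hdiag : b' ^ 2 * τ2' = τ1 + σ1 - τ1' - σ1' := by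
    rw [pow_two, mul_assoc, hoff]
    exact div_mul_cancel₀ _ (mul_ne_zero hb hτ1.ne')
  refine ⟨div_pos hc hD, sub_pos.mpr ((div_lt_comm₀ hS hD).mp hcD), ?_⟩
  have h₁ : b' ^ 2 * τ2' + τ1' + σ1' = τ1 + σ1 := by rw [hdiag]; ring
  have h₂ : τ2' + σ2' = b ^ 2 * τ1 + τ2 + σ2 := add_sub_cancel _ _
  rw [hoff, h₁, h₂]
end

section
/- (Example 2, measure-level non-identifiability of the Gaussian case) For every b ∈ ℝ with b ≠ 0 and every τ1, τ2, σ1, σ2 > 0, there exist b' ∈ ℝ and τ1', τ2', σ1', σ2' > 0 such that the anti-causal law ν(b', τ1', τ2', σ1', σ2') equals the causal law μ(b, τ1, τ2, σ1, σ2) as probability measures on ℝ × ℝ. Hence the causal direction of a linear Gaussian structural equation model observed with Gaussian measurement noise is not identifiable from the observational distribution. -/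
open MeasureTheory ProbabilityTheory
open scoped NNReal

/-- The causal law: law of `(W1, W2) = (Z1 + e1, b·Z1 + ε2 + e2)` where `Z1, ε2, e1, e2` are
independent centered Gaussians with variances `τ1, τ2, σ1, σ2`. -/
noncomputable def causalLaw (b : ℝ) (τ1 τ2 σ1 σ2 : ℝ≥0) : Measure (ℝ × ℝ) :=
  Measure.map (fun q : ℝ × ℝ × ℝ × ℝ => (q.1 + q.2.2.1, b * q.1 + q.2.1 + q.2.2.2))
    ((gaussianReal 0 τ1).prod ((gaussianReal 0 τ2).prod
      ((gaussianReal 0 σ1).prod (gaussianReal 0 σ2))))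

/-- The anti-causal law: law of `(W1, W2) = (b'·Z2' + ε1' + e1', Z2' + e2')` where
`Z2', ε1', e1', e2'` are independent centered Gaussians with variances `τ2', τ1', σ1', σ2'`. -/
noncomputable def antiCausalLaw (b' : ℝ) (τ1' τ2' σ1' σ2' : ℝ≥0) : Measure (ℝ × ℝ) :=
  Measure.map (fun q : ℝ × ℝ × ℝ × ℝ => (b' * q.1 + q.2.1 + q.2.2.1, q.1 + q.2.2.2))
    ((gaussianReal 0 τ2').prod ((gaussianReal 0 τ1').prod
      ((gaussianReal 0 σ1').prod (gaussianReal 0 σ2'))))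

lemma charFunDual_gaussianReal_zero (v : ℝ≥0) (L : StrongDual ℝ ℝ) :
    charFunDual (gaussianReal 0 v) L = Complex.exp (-((v : ℂ) * (L 1 : ℂ) ^ 2 / 2)) := by
  have hL : (L : ℝ → ℝ) = fun x => L 1 * x := by
    ext x
    rw [mul_comm, ← smul_eq_mul, ← map_smul, smul_eq_mul, mul_one]
  rw [charFunDual_eq_charFun_map_one, hL, gaussianReal_map_const_mul, charFun_gaussianReal]
  congr 1
  simp
  ring

/-- Characteristic function of a linear image in the plane of four independent centered
Gaussian variables. -/
lemma charFunDual_map_gaussianReal_prod (v₁ v₂ v₃ v₄ : ℝ≥0) (f : ℝ × ℝ × ℝ × ℝ →L[ℝ] ℝ × ℝ)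
    (L : StrongDual ℝ (ℝ × ℝ)) :
    charFunDual (Measure.map f ((gaussianReal 0 v₁).prod ((gaussianReal 0 v₂).prod
      ((gaussianReal 0 v₃).prod (gaussianReal 0 v₄))))) L =
      Complex.exp (-(((v₁ : ℝ) * L (f (1, 0)) ^ 2 + v₂ * L (f (0, 1, 0)) ^ 2 +
        v₃ * L (f (0, 0, 1, 0)) ^ 2 + v₄ * L (f (0, 0, 0, 1)) ^ 2) / 2 : ℝ)) := by
  rw [charFunDual_map]
  simp only [charFunDual_prod, charFunDual_gaussianReal_zero, ← Complex.exp_add]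
  congr 1
  simp
  ring

lemma charFunDual_causalLaw (b : ℝ) (τ1 τ2 σ1 σ2 : ℝ≥0) (L : StrongDual ℝ (ℝ × ℝ)) :
    charFunDual (causalLaw b τ1 τ2 σ1 σ2) L =
      Complex.exp (-((τ1 * (L (1, 0) + b * L (0, 1)) ^ 2 + τ2 * L (0, 1) ^ 2 +
        σ1 * L (1, 0) ^ 2 + σ2 * L (0, 1) ^ 2) / 2 : ℝ)) := by
  let f : ℝ × ℝ × ℝ × ℝ →L[ℝ] ℝ × ℝ := LinearMap.toContinuousLinearMap
    { toFun := fun q => (q.1 + q.2.2.1, b * q.1 + q.2.1 + q.2.2.2)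
      map_add' := fun x y => by ext <;> simp <;> ring
      map_smul' := fun c x => by ext <;> simp <;> ring }
  have hL : L (1, b) = L (1, 0) + b * L (0, 1) := by
    rw [← smul_eq_mul, ← map_smul, ← map_add]
    simp
  have h := charFunDual_map_gaussianReal_prod τ1 τ2 σ1 σ2 f L
  simpa [f, causalLaw, hL] using h

lemma charFunDual_antiCausalLaw (b' : ℝ) (τ1' τ2' σ1' σ2' : ℝ≥0) (L : StrongDual ℝ (ℝ × ℝ)) :
    charFunDual (antiCausalLaw b' τ1' τ2' σ1' σ2') L =
      Complex.exp (-((τ2' * (b' * L (1, 0) + L (0, 1)) ^ 2 + τ1' * L (1, 0) ^ 2 +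
        σ1' * L (1, 0) ^ 2 + σ2' * L (0, 1) ^ 2) / 2 : ℝ)) := by
  let f : ℝ × ℝ × ℝ × ℝ →L[ℝ] ℝ × ℝ := LinearMap.toContinuousLinearMap
    { toFun := fun q => (b' * q.1 + q.2.1 + q.2.2.1, q.1 + q.2.2.2)
      map_add' := fun x y => by ext <;> simp <;> ring
      map_smul' := fun c x => by ext <;> simp <;> ring }
  have hL : L (b', 1) = b' * L (1, 0) + L (0, 1) := by
    rw [← smul_eq_mul, ← map_smul, ← map_add]
    simp
  have h := charFunDual_map_gaussianReal_prod τ2' τ1' σ1' σ2' f L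
  simpa [f, antiCausalLaw, hL] using h

instance (b : ℝ) (τ1 τ2 σ1 σ2 : ℝ≥0) : IsProbabilityMeasure (causalLaw b τ1 τ2 σ1 σ2) :=
  Measure.isProbabilityMeasure_map (by fun_prop)

instance (b' : ℝ) (τ1' τ2' σ1' σ2' : ℝ≥0) :
    IsProbabilityMeasure (antiCausalLaw b' τ1' τ2' σ1' σ2') :=
  Measure.isProbabilityMeasure_map (by fun_prop)

/-- **Example 2 (measure level).**  The causal direction of a linear Gaussian structural equation
model observed with Gaussian measurement noise is not identifiable: every causal law with `b ≠ 0`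
and strictly positive variances is exactly reproduced by an anti-causal law with suitable strictly
positive parameters. -/
theorem gaussian_case_not_identifiable (b : ℝ) (hb : b ≠ 0) (τ1 τ2 σ1 σ2 : ℝ≥0)
    (hτ1 : 0 < τ1) (hτ2 : 0 < τ2) (hσ1 : 0 < σ1) (hσ2 : 0 < σ2) :
    ∃ (b' : ℝ) (τ1' τ2' σ1' σ2' : ℝ≥0), 0 < τ1' ∧ 0 < τ2' ∧ 0 < σ1' ∧ 0 < σ2' ∧
      antiCausalLaw b' τ1' τ2' σ1' σ2' = causalLaw b τ1 τ2 σ1 σ2 := by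
  have hb2 : 0 < b ^ 2 := by positivity
  let v : ℝ≥0 := ⟨b ^ 2, hb2.le⟩ * τ1 + τ2
  have hv : 0 < v := add_pos_of_nonneg_of_pos zero_le hτ2
  have hv' : (v : ℝ) = b ^ 2 * τ1 + τ2 := rfl
  have hv0 : b ^ 2 * (τ1 : ℝ) + τ2 ≠ 0 := by
    rw [← hv']
    exact_mod_cast hv.ne'
  refine ⟨b * τ1 / v, τ1 * τ2 / v, v, σ1, σ2, by positivity, hv, hσ1, hσ2, ?_⟩
  refine Measure.ext_of_charFunDual ?_
  ext L
  rw [charFunDual_antiCausalLaw, charFunDual_causalLaw]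
  congr 4
  push_cast
  rw [hv']
  field_simp
  ring
end

section
/- (Gaussianity of the induced bivariate observation law) Let b ∈ ℝ and τ1, τ2, σ1, σ2 ≥ 0, and let μ(b, τ1, τ2, σ1, σ2) be the causal law on ℝ × ℝ. Then for all (t1, t2) ∈ ℝ × ℝ, the characteristic function of μ satisfies ∫ exp(i(t1·w1 + t2·w2)) dμ(w1, w2) = exp(−((τ1 + σ1)·t1² + 2bτ1·t1·t2 + (b²τ1 + τ2 + σ2)·t2²)/2); in other words, μ is the centered bivariate Gaussian measure with covariance matrix [[τ1 + σ1, bτ1], [bτ1, b²τ1 + τ2 + σ2]]. -/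
open MeasureTheory ProbabilityTheory
open scoped NNReal

theorem integral_cexp_I_mul_gaussianReal_zero (v : ℝ≥0) (t : ℝ) :
    ∫ x : ℝ, Complex.exp (Complex.I * (t * x : ℝ)) ∂(gaussianReal 0 v) =
      Complex.exp (-(v * t ^ 2 / 2 : ℝ)) := by
  have h := charFun_gaussianReal (μ := 0) (v := v) t
  rw [charFun_apply_real] at h
  simpa [mul_comm Complex.I] using h

/-- **Gaussianity of the induced bivariate observation law.**  The characteristic function of the
causal law is that of the centered bivariate Gaussian with covariance matrix
`[[τ1 + σ1, bτ1], [bτ1, b²τ1 + τ2 + σ2]]`. -/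
theorem causalLaw_charFun (b : ℝ) (τ1 τ2 σ1 σ2 : ℝ≥0) (t1 t2 : ℝ) :
    ∫ w : ℝ × ℝ, Complex.exp (Complex.I * (t1 * w.1 + t2 * w.2 : ℝ))
        ∂(causalLaw b τ1 τ2 σ1 σ2) =
      Complex.exp (-((((τ1 : ℝ) + σ1) * t1 ^ 2 + 2 * b * τ1 * t1 * t2 +
        (b ^ 2 * τ1 + τ2 + σ2) * t2 ^ 2) / 2 : ℝ)) := by
  have hsplit (q : ℝ × ℝ × ℝ × ℝ) :
      Complex.exp (Complex.I * (t1 * (q.1 + q.2.2.1) + t2 * (b * q.1 + q.2.1 + q.2.2.2) : ℝ)) =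
        Complex.exp (Complex.I * ((t1 + b * t2) * q.1 : ℝ)) *
          (Complex.exp (Complex.I * (t2 * q.2.1 : ℝ)) *
            (Complex.exp (Complex.I * (t1 * q.2.2.1 : ℝ)) *
              Complex.exp (Complex.I * (t2 * q.2.2.2 : ℝ)))) := by
    simp only [← Complex.exp_add]
    congr 1
    push_cast
    ring
  rw [causalLaw, integral_map (by fun_prop)
    (Continuous.aestronglyMeasurable (by fun_prop))]
  simp only [hsplit]
  rw [integral_prod_mul (fun x : ℝ => Complex.exp (Complex.I * ((t1 + b * t2) * x : ℝ)))
      (fun p : ℝ × ℝ × ℝ => Complex.exp (Complex.I * (t2 * p.1 : ℝ)) *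
        (Complex.exp (Complex.I * (t1 * p.2.1 : ℝ)) * Complex.exp (Complex.I * (t2 * p.2.2 : ℝ)))),
    integral_prod_mul (fun x : ℝ => Complex.exp (Complex.I * (t2 * x : ℝ)))
      (fun p : ℝ × ℝ =>
        Complex.exp (Complex.I * (t1 * p.1 : ℝ)) * Complex.exp (Complex.I * (t2 * p.2 : ℝ))),
    integral_prod_mul (fun x : ℝ => Complex.exp (Complex.I * (t1 * x : ℝ)))
      (fun x : ℝ => Complex.exp (Complex.I * (t2 * x : ℝ)))]
  simp only [integral_cexp_I_mul_gaussianReal_zero, ← Complex.exp_add]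
  congr 1
  push_cast
  ring
end

section
/- (Identifiability of finite centered Gaussian mixtures on ℝ) Let M, M' ≥ 1, let π : Fin M → ℝ and π' : Fin M' → ℝ be strictly positive weights each summing to 1, and let v : Fin M → ℝ≥0 and v' : Fin M' → ℝ≥0 be strictly positive and pairwise distinct (within each family). If Σ_{m} π_m • gaussianReal 0 (v_m) = Σ_{m} π'_m • gaussianReal 0 (v'_m) as measures on ℝ, then M = M' and there exists a bijection e : Fin M ≃ Fin M' such that v'(e m) = v m and π'(e m) = π m for all m. -/
open MeasureTheory ProbabilityTheory
open scoped NNReal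

/-- The exponential moment of a finite combination of centered Gaussian measures. -/
theorem integral_exp_mul_linearCombination_gaussianReal (f : ℝ≥0 →₀ ℝ≥0) (t : ℝ) :
    ∫ x, Real.exp (t * x) ∂(Finsupp.linearCombination ℝ≥0 (gaussianReal 0) f) =
      f.sum fun v c ↦ (c : ℝ) * Real.exp (v * t ^ 2 / 2) := by
  rw [Finsupp.linearCombination_apply, Finsupp.sum, integral_finsetSum_measure]
  · refine Finset.sum_congr rfl fun v _ ↦ ?_
    have h := congrFun (mgf_id_gaussianReal (μ := 0) (v := v)) t
    simp only [mgf, id_eq, zero_mul, zero_add] at h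
    rw [integral_smul_nnreal_measure, h, NNReal.smul_def, smul_eq_mul]
  · exact fun v _ ↦ (integrable_exp_mul_gaussianReal t).smul_measure_nnreal

/-- The geometric sequences `n ↦ exp v ^ n`, for distinct `v : ℝ≥0`, are linearly independent. -/
theorem linearIndependent_exp_pow :
    LinearIndependent ℝ fun (v : ℝ≥0) (n : Multiplicative ℕ) ↦ Real.exp v ^ n.toAdd := by
  refine (linearIndependent_monoidHom (Multiplicative ℕ) ℝ).comp
    (fun v : ℝ≥0 ↦ powersHom ℝ (Real.exp v)) fun v w h ↦ ?_
  exact NNReal.coe_injective (Real.exp_injective ((powersHom ℝ).injective h))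

/-- The centered Gaussian measures on `ℝ` are linearly independent over `ℝ≥0`. -/
theorem linearIndependent_gaussianReal_zero : LinearIndependent ℝ≥0 (gaussianReal 0) := by
  intro f g hfg
  have key : Finsupp.linearCombination ℝ
      (fun (v : ℝ≥0) (n : Multiplicative ℕ) ↦ Real.exp v ^ n.toAdd)
        (f.mapRange (fun c : ℝ≥0 ↦ (c : ℝ)) NNReal.coe_zero) =
      Finsupp.linearCombination ℝ
      (fun (v : ℝ≥0) (n : Multiplicative ℕ) ↦ Real.exp v ^ n.toAdd)
        (g.mapRange (fun c : ℝ≥0 ↦ (c : ℝ)) NNReal.coe_zero) := by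
    have eval (f : ℝ≥0 →₀ ℝ≥0) (n : Multiplicative ℕ) : Finsupp.linearCombination ℝ
        (fun (v : ℝ≥0) (n : Multiplicative ℕ) ↦ Real.exp v ^ n.toAdd)
          (f.mapRange (fun c : ℝ≥0 ↦ (c : ℝ)) NNReal.coe_zero) n =
        ∫ x, Real.exp (√(2 * n.toAdd) * x) ∂(Finsupp.linearCombination ℝ≥0 (gaussianReal 0) f) := by
      rw [integral_exp_mul_linearCombination_gaussianReal, Finsupp.linearCombination_apply,
        Finsupp.sum_mapRange_index (by simp), Finsupp.sum, Finsupp.sum, Finset.sum_apply]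
      refine Finset.sum_congr rfl fun v _ ↦ ?_
      rw [Real.sq_sqrt (by positivity), Pi.smul_apply, smul_eq_mul, ← Real.exp_nat_mul]
      ring_nf
    funext n
    rw [eval, eval, hfg]
  exact Finsupp.mapRange_injective _ NNReal.coe_zero NNReal.coe_injective
    (linearIndependent_exp_pow key)

/-- **Identifiability of finite centered Gaussian scale mixtures on ℝ.**  If two finite centered
Gaussian scale mixtures with strictly positive weights summing to one and strictly positive,
pairwise distinct variances coincide as measures, then they have the same number of components
and the components match up to a bijection (with matching weights and variances). -/
theorem gaussian_scale_mixture_identifiable {M M' : ℕ} (hM : 1 ≤ M) (hM' : 1 ≤ M')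
    (π : Fin M → ℝ≥0) (π' : Fin M' → ℝ≥0)
    (hπpos : ∀ m, 0 < π m) (hπ'pos : ∀ m, 0 < π' m)
    (hπsum : ∑ m, π m = 1) (hπ'sum : ∑ m, π' m = 1)
    (v : Fin M → ℝ≥0) (v' : Fin M' → ℝ≥0)
    (hvpos : ∀ m, 0 < v m) (hv'pos : ∀ m, 0 < v' m)
    (hvdist : Function.Injective v) (hv'dist : Function.Injective v')
    (hmix : (∑ m, π m • gaussianReal 0 (v m)) = ∑ m, π' m • gaussianReal 0 (v' m)) :
    M = M' ∧ ∃ e : Fin M ≃ Fin M', ∀ m, v' (e m) = v m ∧ π' (e m) = π m := by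
  have hweights : Finsupp.mapDomain v (Finsupp.equivFunOnFinite.symm π) =
      Finsupp.mapDomain v' (Finsupp.equivFunOnFinite.symm π') := by
    apply linearIndependent_gaussianReal_zero
    rw [Finsupp.linearCombination_mapDomain, Finsupp.linearCombination_mapDomain]
    simpa [Finsupp.linearCombination_apply, Finsupp.sum_fintype] using hmix
  have hv (m : Fin M) : Finsupp.mapDomain v (Finsupp.equivFunOnFinite.symm π) (v m) = π m := by
    simp [Finsupp.mapDomain_apply hvdist]
  have hv' (m : Fin M') :
      Finsupp.mapDomain v' (Finsupp.equivFunOnFinite.symm π') (v' m) = π' m := by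
    simp [Finsupp.mapDomain_apply hv'dist]
  have hrange : Set.range v = Set.range v' := by
    apply Set.Subset.antisymm
    · rintro _ ⟨m, rfl⟩
      by_contra h
      have := hv m
      rw [hweights, Finsupp.mapDomain_of_notMem_range _ _ h] at this
      exact (hπpos m).ne this
    · rintro _ ⟨m, rfl⟩
      by_contra h
      have := hv' m
      rw [← hweights, Finsupp.mapDomain_of_notMem_range _ _ h] at this
      exact (hπ'pos m).ne this
  let e : Fin M ≃ Fin M' := (Equiv.ofInjective v hvdist).trans
    ((Equiv.setCongr hrange).trans (Equiv.ofInjective v' hv'dist).symm)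
  have he (m : Fin M) : v' (e m) = v m := by
    simp [e, Equiv.apply_ofInjective_symm]
  refine ⟨Fin.equiv_iff_eq.mp ⟨e⟩, e, fun m ↦ ⟨he m, ?_⟩⟩
  rw [← hv', he, ← hweights, hv]
end

section
/- (Nondegenerate Gaussian scale mixtures are non-Gaussian) Let π ∈ (0, 1) and let v1, v2 > 0 with v1 ≠ v2. Then for every m ∈ ℝ and every v ≥ 0, the mixture measure π • gaussianReal 0 v1 + (1 − π) • gaussianReal 0 v2 is not equal to gaussianReal m v. -/
open MeasureTheory ProbabilityTheory
open scoped NNReal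

/-- The moment generating function of a two-component mixture of centered Gaussians. -/
lemma mgf_gaussian_scale_mixture (p q v1 v2 : ℝ≥0) (t : ℝ) :
    mgf id (p • gaussianReal 0 v1 + q • gaussianReal 0 v2) t =
      p * Real.exp (v1 * t ^ 2 / 2) + q * Real.exp (v2 * t ^ 2 / 2) := by
  have hint (r w : ℝ≥0) : Integrable (fun x ↦ Real.exp (t * id x)) (r • gaussianReal 0 w) :=
    (integrable_exp_mul_gaussianReal t).smul_measure_nnreal
  have hmgf (w : ℝ≥0) :
      ∫ x, Real.exp (t * id x) ∂gaussianReal 0 w = Real.exp (w * t ^ 2 / 2) := by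
    simpa [mgf] using congrFun (mgf_id_gaussianReal (μ := 0) (v := w)) t
  rw [mgf, integral_add_measure (hint p v1) (hint q v2), integral_smul_nnreal_measure,
    integral_smul_nnreal_measure, hmgf, hmgf]
  rfl

/-- Equality in the strict convexity of the square. -/
lemma eq_of_convex_comb_sq_eq {p x y z : ℝ} (hp0 : 0 < p) (hp1 : p < 1)
    (h1 : p * x + (1 - p) * y = z) (h2 : p * x ^ 2 + (1 - p) * y ^ 2 = z ^ 2) : x = y := by
  have h : p * (1 - p) * (x - y) ^ 2 = 0 := by
    subst h1
    linear_combination h2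
  have hpq : p * (1 - p) ≠ 0 := (mul_pos hp0 (sub_pos.2 hp1)).ne'
  exact sub_eq_zero.1 (pow_eq_zero_iff two_ne_zero |>.1 ((mul_eq_zero.1 h).resolve_left hpq))

/-- **Nondegenerate Gaussian scale mixtures are non-Gaussian.**  A proper two-component mixture
of centered Gaussians with distinct positive variances is not a Gaussian measure. -/
theorem gaussian_scale_mixture_not_gaussian (π : ℝ≥0) (hπ0 : 0 < π) (hπ1 : π < 1)
    (v1 v2 : ℝ≥0) (hv1 : 0 < v1) (hv2 : 0 < v2) (hne : v1 ≠ v2) :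
    ∀ (m : ℝ) (v : ℝ≥0),
      π • gaussianReal 0 v1 + (1 - π) • gaussianReal 0 v2 ≠ gaussianReal m v := by
  intro m v h
  have key (t : ℝ) : (π : ℝ) * Real.exp (v1 * t ^ 2 / 2) + (1 - π) * Real.exp (v2 * t ^ 2 / 2) =
      Real.exp (m * t + v * t ^ 2 / 2) := by
    rw [← congrFun (mgf_id_gaussianReal (μ := m) (v := v)) t, ← h, mgf_gaussian_scale_mixture,
      NNReal.coe_sub hπ1.le, NNReal.coe_one]
  have hm : m = 0 := by
    have hpos := key 1
    have hneg := key (-1)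
    rw [one_pow] at hpos
    rw [neg_one_sq] at hneg
    linarith [Real.exp_injective (hpos.symm.trans hneg)]
  subst hm
  have hexp : Real.exp v1 = Real.exp v2 := by
    refine eq_of_convex_comb_sq_eq (z := Real.exp v) (NNReal.coe_pos.2 hπ0)
      (NNReal.coe_lt_one.2 hπ1) ?_ ?_
    · simpa using key (√2)
    · have h2 (w : ℝ) : Real.exp w ^ 2 = Real.exp (w * 2 ^ 2 / 2) := by
        rw [← Real.exp_nat_mul]
        congr 1
        push_cast
        ring
      simpa only [h2, zero_mul, zero_add] using key 2
  exact hne (NNReal.coe_injective (Real.exp_injective hexp))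
end
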